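/- Let β ∈ ℝ∖ℤ, and for n ∈ ℕ let a_n(β) be the n-th derivative at t = 0 of the function t ↦ 1/(1 − e^{−t} e^{2πiβ}). Define ψ_β(x) := lim_{N→∞} Σ_{q=0}^{N} e^{2πiβq}/(x+q), which converges (as a limit of partial sums) for every x ∈ ℂ∖{0, −1, −2, …}. Then for every δ ∈ (0, π) and every N ∈ ℕ, ψ_β(x) − Σ_{n=0}^{N−1} a_n(β) x^{−(n+1)} = O(|x|^{−(N+1)}) as |x| → ∞ within the sector {x ∈ ℂ∖{0} : |arg(x)| ≤ π − δ}. -/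

import Mathlib

open Complex MeasureTheory Filter Topology Set Asymptotics

noncomputable section

/-- `e2pi θ = e^{2πiθ}`. -/
def e2pi (θ : ℝ) : ℂ := Complex.exp (2 * Real.pi * Complex.I * θ)

/-- `a_n(β)`: the `n`-th derivative at `t = 0` of `t ↦ 1/(1 - e^{-t} e^{2πiβ})`. -/
def aCoeff (n : ℕ) (β : ℝ) : ℂ :=
  iteratedDeriv n (fun t : ℂ => (1 - Complex.exp (-t) * e2pi β)⁻¹) 0

/-- `ψ_β(x) = ∑_{q≥0} e^{2πiβq}/(x+q)`, summed as the limit of its partial sums. -/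
def psiBeta (β : ℝ) (x : ℂ) : ℂ :=
  limUnder atTop (fun N : ℕ => ∑ q ∈ Finset.range (N + 1), e2pi (β * q) / (x + q))

/-- The filter of `x → ∞` within the sector `|arg x| ≤ π - δ`. -/
def sectorAtInfty (δ : ℝ) : Filter ℂ :=
  comap (fun x : ℂ => ‖x‖) atTop ⊓ 𝓟 {x : ℂ | x ≠ 0 ∧ |Complex.arg x| ≤ Real.pi - δ}

theorem e2pi_mul_natCast (β : ℝ) (q : ℕ) : e2pi (β * q) = e2pi β ^ q := by
  unfold e2pi
  rw [← Complex.exp_nat_mul]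
  push_cast
  ring_nf

theorem norm_e2pi (β : ℝ) : ‖e2pi β‖ = 1 := by
  unfold e2pi
  rw [show (2 * Real.pi * Complex.I * β : ℂ) = ((2 * Real.pi * β : ℝ) : ℂ) * Complex.I by
    push_cast; ring]
  exact Complex.norm_exp_ofReal_mul_I _

theorem e2pi_ne_one {β : ℝ} (hβ : ∀ n : ℤ, β ≠ n) : e2pi β ≠ 1 := by
  intro h
  obtain ⟨n, hn⟩ := Complex.exp_eq_one_iff.1 h
  have h2 : (2 * Real.pi * Complex.I : ℂ) ≠ 0 := Complex.two_pi_I_ne_zero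
  have h3 : (β : ℂ) = n := mul_left_cancel₀ h2 (by rw [hn]; ring)
  exact hβ n (by exact_mod_cast h3)

/-- The recurrence for `a_n(β)` obtained by differentiating `g(t) = 1 + e^{2πiβ} e^{-t} g(t)`. -/
theorem aCoeff_recurrence {β : ℝ} (hβ : ∀ n : ℤ, β ≠ n) (n : ℕ) :
    aCoeff n β = (if n = 0 then 1 else 0) +
      e2pi β * ∑ k ∈ Finset.range (n + 1), (-1) ^ (n + k) * (n.choose k : ℂ) * aCoeff k β := by
  set w := e2pi β with hw
  set g : ℂ → ℂ := fun t => (1 - Complex.exp (-t) * w)⁻¹ with hg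
  have hne : (1 - Complex.exp (-0) * w : ℂ) ≠ 0 := by
    simpa [sub_eq_zero] using (e2pi_ne_one hβ).symm
  have hgd : ∀ m : ℕ, ContDiffAt ℂ m g 0 := fun m => ContDiffAt.inv (by fun_prop) hne
  have heq : g =ᶠ[𝓝 0] fun t => 1 + w * (g t * Complex.exp ((-1) * t)) := by
    have hc : ContinuousAt (fun t : ℂ => 1 - Complex.exp (-t) * w) 0 := by fun_prop
    filter_upwards [hc.eventually_ne hne] with t ht
    simp only [hg, neg_one_mul]
    field_simp
    ring
  have hed : ContDiffAt ℂ n (fun t : ℂ => Complex.exp ((-1) * t)) 0 := by fun_prop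
  change iteratedDeriv n g 0 = _
  rw [heq.iteratedDeriv_eq, iteratedDeriv_fun_add contDiffAt_const
    (contDiffAt_const.mul ((hgd n).mul hed)), iteratedDeriv_const, iteratedDeriv_const_mul_field,
    iteratedDeriv_fun_mul (hgd n) hed]
  congr 2
  refine Finset.sum_congr rfl fun k hk => ?_
  have hkn : k ≤ n := by simpa [Nat.lt_succ_iff] using hk
  rw [iteratedDeriv_cexp_const_mul]
  have hs : (-1 : ℂ) ^ (n - k) = (-1) ^ (n + k) := by
    rw [show n + k = (n - k) + 2 * k by omega, pow_add, pow_mul]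
    simp
  simp only [mul_zero, Complex.exp_zero, mul_one, hs]
  change _ * iteratedDeriv k g 0 * _ = _ * iteratedDeriv k g 0
  ring

theorem binomial_remainder_recurrence {y u : ℂ} (h : u * (1 + y) = y) (n N : ℕ) :
    (1 + y) * (u ^ (n + 2) - ∑ m ∈ Finset.range (N + 1),
        (-1) ^ (m + (n + 1)) * (m.choose (n + 1) : ℂ) * y ^ (m + 1)) =
      y * (u ^ (n + 1) - ∑ m ∈ Finset.range N, (-1) ^ (m + n) * (m.choose n : ℂ) * y ^ (m + 1)) -
        (-1) ^ (N + (n + 1)) * (N.choose (n + 1) : ℂ) * y ^ (N + 2) := by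
  induction N with
  | zero =>
    simp only [zero_add, Finset.sum_range_one, Nat.choose_zero_succ, Finset.sum_range_zero]
    linear_combination u ^ (n + 1) * h
  | succ N ih =>
    rw [Finset.sum_range_succ _ (N + 1), Finset.sum_range_succ (fun m => (-1) ^ (m + n) * _ * _) N,
      Nat.choose_succ_succ]
    push_cast
    linear_combination ih

theorem geometric_remainder {y u : ℂ} (h : u * (1 + y) = y) (N : ℕ) :
    u - ∑ m ∈ Finset.range N, (-1) ^ m * y ^ (m + 1) = (-1) ^ N * y ^ N * u := by
  induction N with
  | zero => simp
  | succ N ih =>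
    rw [Finset.sum_range_succ]
    linear_combination ih + (-1) ^ N * y ^ N * h

theorem norm_le_two_mul_of_mul_one_add {y v : ℂ} (hy : ‖y‖ ≤ 1 / 2) :
    ‖v‖ ≤ 2 * ‖(1 + y) * v‖ := by
  have h1 : (1 / 2 : ℝ) ≤ ‖1 + y‖ := by
    have := norm_sub_norm_le (1 : ℂ) (-y)
    simp only [norm_one, norm_neg, sub_neg_eq_add] at this
    linarith
  rw [norm_mul]
  nlinarith [norm_nonneg v]

/-- Truncated binomial expansion of `u ^ (n + 1)`, `u = y / (1 + y)`, in powers of `y`. -/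
theorem exists_binomial_remainder_bound (N n : ℕ) :
    ∃ C : ℝ, 0 ≤ C ∧ ∀ y u : ℂ, ‖y‖ ≤ 1 / 2 → u * (1 + y) = y →
      ‖u ^ (n + 1) - ∑ m ∈ Finset.range N, (-1) ^ (m + n) * (m.choose n : ℂ) * y ^ (m + 1)‖ ≤
        C * ‖y‖ ^ (N + 1) := by
  have hu2 : ∀ y u : ℂ, ‖y‖ ≤ 1 / 2 → u * (1 + y) = y → ‖u‖ ≤ 2 * ‖y‖ := by
    intro y u hy h
    simpa [mul_comm (1 + y), h] using norm_le_two_mul_of_mul_one_add (v := u) hy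
  induction N generalizing n with
  | zero =>
    refine ⟨2, by norm_num, fun y u hy h => ?_⟩
    have h1 := hu2 y u hy h
    have h2 : ‖u‖ ^ n ≤ 1 := pow_le_one₀ (norm_nonneg _) (by linarith)
    rw [Finset.sum_range_zero, sub_zero, norm_pow, zero_add, pow_one, pow_succ]
    nlinarith [norm_nonneg u]
  | succ N ih =>
    cases n with
    | zero =>
      refine ⟨2, by norm_num, fun y u hy h => ?_⟩
      have h1 := hu2 y u hy h
      have h2 := geometric_remainder h (N + 1)
      simp only [zero_add, pow_one, add_zero, Nat.choose_zero_right, Nat.cast_one, mul_one]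
      rw [h2]
      simp only [norm_mul, norm_pow, norm_neg, norm_one, one_pow, one_mul]
      rw [pow_succ _ (N + 1)]
      nlinarith [pow_nonneg (norm_nonneg y) (N + 1)]
    | succ n =>
      obtain ⟨C, hC, hb⟩ := ih n
      refine ⟨2 * (C + N.choose (n + 1)), by positivity, fun y u hy h => ?_⟩
      refine (norm_le_two_mul_of_mul_one_add hy).trans ?_
      rw [binomial_remainder_recurrence h n N, mul_assoc 2]
      refine mul_le_mul_of_nonneg_left ((norm_sub_le _ _).trans ?_) zero_le_two
      have h3 := mul_le_mul_of_nonneg_left (hb y u hy h) (norm_nonneg y)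
      rw [norm_mul]
      simp only [norm_mul, norm_pow, norm_neg, norm_one, one_pow, one_mul, Complex.norm_natCast]
      calc _ ≤ ‖y‖ * (C * ‖y‖ ^ (N + 1)) + (N.choose (n + 1)) * ‖y‖ ^ (N + 2) := by gcongr
        _ = _ := by ring

/-- The partial sum `∑_{n<N} a_n(β) x^{-(n+1)}` of the asymptotic expansion of `ψ_β`. -/
def psiTrunc (β : ℝ) (N : ℕ) (x : ℂ) : ℂ :=
  ∑ n ∈ Finset.range N, aCoeff n β * x⁻¹ ^ (n + 1)

/-- The defect of `psiTrunc` in the functional equation `ψ_β(x) - e^{2πiβ} ψ_β(x+1) = 1/x`. -/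
def psiDefect (β : ℝ) (N : ℕ) (x : ℂ) : ℂ :=
  psiTrunc β N x - e2pi β * psiTrunc β N (x + 1) - x⁻¹

theorem psiDefect_eq {β : ℝ} (hβ : ∀ n : ℤ, β ≠ n) (N : ℕ) (x : ℂ) :
    psiDefect β (N + 1) x = -e2pi β * ∑ n ∈ Finset.range (N + 1), aCoeff n β *
      ((x + 1)⁻¹ ^ (n + 1) - ∑ m ∈ Finset.range (N + 1),
        (-1) ^ (m + n) * (m.choose n : ℂ) * x⁻¹ ^ (m + 1)) := by
  have h1 : psiTrunc β (N + 1) x = x⁻¹ + e2pi β * ∑ n ∈ Finset.range (N + 1), aCoeff n β *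
      ∑ m ∈ Finset.range (N + 1), (-1) ^ (m + n) * (m.choose n : ℂ) * x⁻¹ ^ (m + 1) := by
    have hrec : ∀ m ∈ Finset.range (N + 1), aCoeff m β * x⁻¹ ^ (m + 1) =
        (if m = 0 then x⁻¹ else 0) + e2pi β * ∑ n ∈ Finset.range (N + 1), aCoeff n β *
          ((-1) ^ (m + n) * (m.choose n : ℂ) * x⁻¹ ^ (m + 1)) := by
      intro m hm
      have hext : ∑ k ∈ Finset.range (m + 1), (-1) ^ (m + k) * (m.choose k : ℂ) * aCoeff k β =
          ∑ k ∈ Finset.range (N + 1), (-1) ^ (m + k) * (m.choose k : ℂ) * aCoeff k β := by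
        refine Finset.sum_subset (Finset.range_mono (Finset.mem_range.1 hm)) fun k _ hk => ?_
        rw [Nat.choose_eq_zero_of_lt (by simpa using hk)]
        simp
      rw [aCoeff_recurrence hβ m, hext, add_mul, mul_assoc, Finset.sum_mul]
      congr 1
      · split_ifs with h0 <;> simp [h0]
      · congr 1
        exact Finset.sum_congr rfl fun _ _ => by ring
    rw [psiTrunc, Finset.sum_congr rfl hrec, Finset.sum_add_distrib, ← Finset.mul_sum,
      Finset.sum_comm]
    simp [Finset.mul_sum]
  rw [psiDefect, h1, psiTrunc]
  simp only [mul_sub, Finset.sum_sub_distrib]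
  ring

theorem exists_norm_psiDefect_le {β : ℝ} (hβ : ∀ n : ℤ, β ≠ n) (N : ℕ) :
    ∃ C : ℝ, 0 ≤ C ∧ ∀ x : ℂ, 2 ≤ ‖x‖ → ‖psiDefect β (N + 1) x‖ ≤ C * ‖x‖⁻¹ ^ (N + 2) := by
  choose C hC hb using exists_binomial_remainder_bound (N + 1)
  refine ⟨∑ n ∈ Finset.range (N + 1), ‖aCoeff n β‖ * C n,
    Finset.sum_nonneg fun n _ => mul_nonneg (norm_nonneg _) (hC n), fun x hx => ?_⟩
  have hx0 : x ≠ 0 := by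
    rintro rfl
    norm_num at hx
  have hx1 : x + 1 ≠ 0 := by
    intro h
    rw [eq_neg_of_add_eq_zero_left h] at hx
    norm_num at hx
  have hy : ‖x⁻¹‖ ≤ 1 / 2 := by
    rw [norm_inv, one_div]
    exact inv_anti₀ two_pos hx
  have hu : (x + 1)⁻¹ * (1 + x⁻¹) = x⁻¹ := by
    field_simp
  rw [psiDefect_eq hβ, norm_mul, norm_neg, norm_e2pi, one_mul, Finset.sum_mul]
  refine (norm_sum_le _ _).trans (Finset.sum_le_sum fun n _ => ?_)
  rw [norm_mul, mul_assoc, ← norm_inv]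
  exact mul_le_mul_of_nonneg_left (hb n _ _ hy hu) (norm_nonneg _)

theorem sum_range_eq_psiTrunc_sub (β : ℝ) (N Q : ℕ) (x : ℂ) :
    ∑ q ∈ Finset.range Q, e2pi (β * q) / (x + q) =
      psiTrunc β N x - e2pi β ^ Q * psiTrunc β N (x + Q) -
        ∑ q ∈ Finset.range Q, e2pi β ^ q * psiDefect β N (x + q) := by
  induction Q with
  | zero => simp
  | succ Q ih =>
    rw [Finset.sum_range_succ, Finset.sum_range_succ, ih, e2pi_mul_natCast, psiDefect]
    push_cast
    rw [← add_assoc]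
    ring

theorem tendsto_norm_add_natCast_atTop (x : ℂ) :
    Tendsto (fun q : ℕ => ‖x + q‖) atTop atTop := by
  refine tendsto_atTop_mono (fun q => ?_)
    (tendsto_atTop_add_const_right _ (-‖x‖) tendsto_natCast_atTop_atTop)
  have := norm_sub_norm_le (q : ℂ) (-x)
  rw [sub_neg_eq_add, norm_neg, Complex.norm_natCast, add_comm (q : ℂ)] at this
  linarith

theorem tendsto_psiTrunc_add_natCast (β : ℝ) (N : ℕ) (x : ℂ) :
    Tendsto (fun Q : ℕ => e2pi β ^ Q * psiTrunc β N (x + Q)) atTop (𝓝 0) := by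
  have h0 : Tendsto (fun Q : ℕ => (x + Q)⁻¹) atTop (𝓝 0) :=
    tendsto_inv₀_cobounded.comp
      (tendsto_norm_atTop_iff_cobounded.1 (tendsto_norm_add_natCast_atTop x))
  have h1 : Tendsto (fun Q : ℕ => psiTrunc β N (x + Q)) atTop (𝓝 0) := by
    unfold psiTrunc
    have := tendsto_finsetSum (Finset.range N)
      fun n _ => (h0.pow (n + 1)).const_mul (aCoeff n β)
    simpa using this
  rw [tendsto_zero_iff_norm_tendsto_zero] at h1 ⊢
  simpa [norm_e2pi] using h1

theorem summable_psiDefect {β : ℝ} (hβ : ∀ n : ℤ, β ≠ n) (x : ℂ) :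
    Summable fun q : ℕ => e2pi β ^ q * psiDefect β 1 (x + q) := by
  obtain ⟨C, hC, hb⟩ := exists_norm_psiDefect_le hβ 0
  refine Summable.of_norm_bounded_eventually_nat (g := fun q : ℕ => 4 * C * (1 / (q : ℝ) ^ 2))
    ((Real.summable_one_div_nat_pow.2 one_lt_two).mul_left _) ?_
  filter_upwards [(tendsto_norm_add_natCast_atTop x).eventually_ge_atTop 2,
    eventually_ge_atTop (⌈2 * ‖x‖⌉₊ + 1)] with q hq2 hq
  have hq1 : 2 * ‖x‖ ≤ q := (Nat.le_ceil _).trans (by exact_mod_cast (Nat.le_succ _).trans hq)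
  have hq0 : (0 : ℝ) < q := by exact_mod_cast (Nat.succ_pos _).trans_le hq
  have hxq : (q : ℝ) / 2 ≤ ‖x + q‖ := by
    have := norm_sub_norm_le (q : ℂ) (-x)
    rw [sub_neg_eq_add, norm_neg, Complex.norm_natCast, add_comm (q : ℂ)] at this
    linarith
  rw [norm_mul, norm_pow, norm_e2pi, one_pow, one_mul]
  calc ‖psiDefect β 1 (x + q)‖ ≤ C * ‖x + q‖⁻¹ ^ 2 := hb _ hq2
    _ ≤ C * ((q : ℝ) / 2)⁻¹ ^ 2 := by gcongr
    _ = 4 * C * (1 / (q : ℝ) ^ 2) := by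
      field_simp
      norm_num

theorem exists_tendsto_psiBeta {β : ℝ} (hβ : ∀ n : ℤ, β ≠ n) (x : ℂ) :
    ∃ L : ℂ, Tendsto (fun N : ℕ => ∑ q ∈ Finset.range (N + 1), e2pi (β * q) / (x + q))
      atTop (𝓝 L) := by
  have h := ((tendsto_const_nhds (x := psiTrunc β 1 x)).sub (tendsto_psiTrunc_add_natCast β 1 x)).sub
    (summable_psiDefect hβ x).hasSum.tendsto_sum_nat
  simp only [← sum_range_eq_psiTrunc_sub] at h
  exact ⟨_, h.comp (tendsto_add_atTop_nat 1)⟩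

theorem tendsto_psiBeta {β : ℝ} (hβ : ∀ n : ℤ, β ≠ n) (x : ℂ) :
    Tendsto (fun Q : ℕ => ∑ q ∈ Finset.range Q, e2pi (β * q) / (x + q))
      atTop (𝓝 (psiBeta β x)) :=
  (tendsto_add_atTop_iff_nat 1).1 (tendsto_nhds_limUnder (exists_tendsto_psiBeta hβ x))

/-- In the sector `|arg x| ≤ π - δ`, a nonnegative shift cannot bring `x` close to `0`. -/
theorem sin_half_mul_le_norm_add {δ : ℝ} (hδ : 0 < δ) {x : ℂ}
    (hx : |Complex.arg x| ≤ Real.pi - δ) {q : ℝ} (hq : 0 ≤ q) :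
    Real.sin (δ / 2) * (‖x‖ + q) ≤ ‖x + q‖ := by
  have hcos : -Real.cos δ ≤ Real.cos (Complex.arg x) := by
    rw [← Real.cos_pi_sub, ← Real.cos_abs (Complex.arg x)]
    exact Real.cos_le_cos_of_nonneg_of_le_pi (abs_nonneg _) (by linarith) hx
  have hre : -Real.cos δ * ‖x‖ ≤ x.re := by
    rw [← Complex.norm_mul_cos_arg x, mul_comm]
    exact mul_le_mul_of_nonneg_left hcos (norm_nonneg x)
  have hsin : Real.sin (δ / 2) ^ 2 = (1 - Real.cos δ) / 2 := by
    rw [Real.sin_sq_eq_half_sub, mul_div_cancel₀ δ two_ne_zero]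
    ring
  refine le_of_sq_le_sq ?_ (norm_nonneg _)
  have hsq : ‖x + q‖ ^ 2 = ‖x‖ ^ 2 + 2 * q * x.re + q ^ 2 := by
    rw [← Complex.normSq_eq_norm_sq, ← Complex.normSq_eq_norm_sq, Complex.normSq_apply,
      Complex.normSq_apply]
    simp
    ring
  rw [mul_pow, hsin, hsq]
  nlinarith [mul_le_mul_of_nonneg_left hre hq, Real.neg_one_le_cos δ,
    mul_nonneg (by linarith [Real.neg_one_le_cos δ] : 0 ≤ 1 + Real.cos δ) (sq_nonneg (‖x‖ - q))]

theorem sum_inv_add_sq_le {r : ℝ} (hr : 2 ≤ r) (Q : ℕ) :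
    ∑ q ∈ Finset.range Q, (r + q)⁻¹ ^ 2 ≤ 2 * r⁻¹ := by
  have h : ∑ q ∈ Finset.range Q, (r + q)⁻¹ ^ 2 ≤ (r - 1)⁻¹ - (r + Q - 1)⁻¹ := by
    induction Q with
    | zero => simp
    | succ Q ih =>
      rw [Finset.sum_range_succ]
      have hQ : (0 : ℝ) ≤ Q := Nat.cast_nonneg Q
      have h1 : 0 < r + Q - 1 := by linarith
      have h2 : 0 < r + Q := by linarith
      have : (r + Q)⁻¹ ^ 2 ≤ (r + Q - 1)⁻¹ - (r + Q)⁻¹ := by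
        rw [inv_sub_inv h1.ne' h2.ne', inv_pow, ← one_div]
        refine div_le_div₀ (by linarith) (by linarith) (by positivity) ?_
        nlinarith
      push_cast
      rw [show r + (Q + 1) - 1 = r + (Q : ℝ) by ring]
      linarith
  have hQ : (0 : ℝ) ≤ (r + Q - 1)⁻¹ :=
    inv_nonneg.2 (by linarith [(Nat.cast_nonneg Q : (0 : ℝ) ≤ Q)])
  have hr1 : (r - 1)⁻¹ ≤ 2 * r⁻¹ := by
    rw [← div_eq_mul_inv, ← one_div, div_le_div_iff₀ (by linarith) (by linarith)]
    linarith
  linarith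

theorem exists_norm_psiBeta_sub_psiTrunc_le {β : ℝ} (hβ : ∀ n : ℤ, β ≠ n) {δ : ℝ} (hδ : 0 < δ)
    (hδπ : δ < Real.pi) (N : ℕ) :
    ∃ C r : ℝ, ∀ x : ℂ, r ≤ ‖x‖ → |Complex.arg x| ≤ Real.pi - δ →
      ‖psiBeta β x - psiTrunc β (N + 1) x‖ ≤ C * ‖x‖⁻¹ ^ (N + 1) := by
  obtain ⟨C, hC, hb⟩ := exists_norm_psiDefect_le hβ N
  set c := Real.sin (δ / 2) with hc
  have hc0 : 0 < c := Real.sin_pos_of_pos_of_lt_pi (by linarith) (by linarith)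
  refine ⟨2 * C * c⁻¹ ^ (N + 2), max 2 (2 / c), fun x hxr hx => ?_⟩
  have hx2 : 2 ≤ ‖x‖ := (le_max_left _ _).trans hxr
  have hxc : 2 ≤ c * ‖x‖ := by
    rw [mul_comm]
    exact (div_le_iff₀ hc0).1 ((le_max_right _ _).trans hxr)
  have hx0 : 0 < ‖x‖ := by linarith
  have hterm : ∀ q : ℕ, ‖e2pi β ^ q * psiDefect β (N + 1) (x + q)‖ ≤
      C * c⁻¹ ^ (N + 2) * ‖x‖⁻¹ ^ N * (‖x‖ + q)⁻¹ ^ 2 := by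
    intro q
    have hq : (0 : ℝ) ≤ q := Nat.cast_nonneg q
    have hs : c * (‖x‖ + q) ≤ ‖x + q‖ := by
      simpa using sin_half_mul_le_norm_add hδ hx hq
    have h2 : 2 ≤ ‖x + q‖ := by nlinarith
    rw [norm_mul, norm_pow, norm_e2pi, one_pow, one_mul]
    calc ‖psiDefect β (N + 1) (x + q)‖ ≤ C * ‖x + q‖⁻¹ ^ (N + 2) := hb _ h2
      _ ≤ C * (c * (‖x‖ + q))⁻¹ ^ (N + 2) := by gcongr
      _ = C * c⁻¹ ^ (N + 2) * (‖x‖ + q)⁻¹ ^ N * (‖x‖ + q)⁻¹ ^ 2 := by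
        rw [mul_inv, mul_pow, pow_add (‖x‖ + q)⁻¹]
        ring
      _ ≤ C * c⁻¹ ^ (N + 2) * ‖x‖⁻¹ ^ N * (‖x‖ + q)⁻¹ ^ 2 := by
        gcongr
        linarith
  have hlim : Tendsto (fun Q : ℕ => ∑ q ∈ Finset.range Q, e2pi (β * q) / (x + q) -
      psiTrunc β (N + 1) x + e2pi β ^ Q * psiTrunc β (N + 1) (x + Q)) atTop
      (𝓝 (psiBeta β x - psiTrunc β (N + 1) x)) := by
    simpa using ((tendsto_psiBeta hβ x).sub_const (psiTrunc β (N + 1) x)).add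
      (tendsto_psiTrunc_add_natCast β (N + 1) x)
  refine le_of_tendsto hlim.norm (Eventually.of_forall fun Q => ?_)
  rw [sum_range_eq_psiTrunc_sub β (N + 1), show ∀ a b s : ℂ, a - b - s - a + b = -s by
    intros; ring, norm_neg]
  calc _ ≤ ∑ q ∈ Finset.range Q, C * c⁻¹ ^ (N + 2) * ‖x‖⁻¹ ^ N * (‖x‖ + q)⁻¹ ^ 2 :=
        norm_sum_le_of_le _ fun q _ => hterm q
    _ = C * c⁻¹ ^ (N + 2) * ‖x‖⁻¹ ^ N * ∑ q ∈ Finset.range Q, (‖x‖ + q)⁻¹ ^ 2 := by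
        rw [Finset.mul_sum]
    _ ≤ C * c⁻¹ ^ (N + 2) * ‖x‖⁻¹ ^ N * (2 * ‖x‖⁻¹) := by
        gcongr
        exact sum_inv_add_sq_le hx2 Q
    _ = _ := by ring

/-- Asymptotic expansion of `ψ_β`: for `β ∉ ℤ`, the series defining `ψ_β(x)` converges for all
`x` outside `{0, -1, -2, …}`, and for each `δ ∈ (0, π)` and `N`,
`ψ_β(x) - ∑_{n<N} a_n(β) x^{-(n+1)} = O(|x|^{-(N+1)})` as `|x| → ∞` in the sector
`|arg x| ≤ π - δ`. -/
theorem psiBeta_asymptotic (β : ℝ) (hβ : ∀ n : ℤ, β ≠ n) :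
    (∀ x : ℂ, (∀ m : ℕ, x ≠ -(m : ℂ)) →
      ∃ L : ℂ, Tendsto (fun N : ℕ => ∑ q ∈ Finset.range (N + 1), e2pi (β * q) / (x + q))
        atTop (𝓝 L)) ∧
    ∀ δ : ℝ, 0 < δ → δ < Real.pi → ∀ N : ℕ,
      (fun x : ℂ => psiBeta β x - ∑ n ∈ Finset.range N, aCoeff n β * x ^ (-(n + 1) : ℤ))
        =O[sectorAtInfty δ]
      (fun x : ℂ => ‖x‖ ^ (-(N + 1) : ℤ)) := by
  refine ⟨fun x _ => exists_tendsto_psiBeta hβ x, fun δ hδ hδπ N => ?_⟩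
  obtain ⟨C, r, hb⟩ := exists_norm_psiBeta_sub_psiTrunc_le hβ hδ hδπ N
  have hzpow : ∀ (K : Type) [DivisionRing K] (y : K) (n : ℕ),
      y ^ (-(n + 1) : ℤ) = y⁻¹ ^ (n + 1) := by
    intro K _ y n
    rw [zpow_neg, inv_pow]
    norm_cast
  refine IsBigO.of_bound (C + ‖aCoeff N β‖) ?_
  have hfar : ∀ᶠ x in sectorAtInfty δ, r ≤ ‖x‖ :=
    (tendsto_comap.mono_left inf_le_left).eventually_ge_atTop r
  have hsec : ∀ᶠ x in sectorAtInfty δ, x ≠ 0 ∧ |Complex.arg x| ≤ Real.pi - δ :=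
    (le_principal_iff.1 inf_le_right : _ ∈ sectorAtInfty δ)
  filter_upwards [hfar, hsec] with x hxr hx
  simp only [hzpow]
  have hsucc : psiTrunc β (N + 1) x = ∑ n ∈ Finset.range N, aCoeff n β * x⁻¹ ^ (n + 1) +
      aCoeff N β * x⁻¹ ^ (N + 1) := Finset.sum_range_succ _ _
  have hsplit : psiBeta β x - ∑ n ∈ Finset.range N, aCoeff n β * x⁻¹ ^ (n + 1) =
      (psiBeta β x - psiTrunc β (N + 1) x) + aCoeff N β * x⁻¹ ^ (N + 1) := by
    rw [hsucc]
    ring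
  rw [hsplit, add_mul]
  refine (norm_add_le _ _).trans (add_le_add ?_ ?_)
  · simpa using hb x hxr hx.2
  · simp

end
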